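/- Let p, q ≥ 2 be integers and let ℓ ≥ 1 divide both p and q − 1; set N = (p−1)(q−1)/ℓ (an integer since ℓ divides q−1). Then the permutation of ZMod N given by c ↦ c − q has exactly gcd(q, (p+q−1)/ℓ) orbits, and every orbit has cardinality (p−1)(q−1)/gcd(ℓ·q, p+q−1). In particular gcd(N, q) = gcd(q, (p+q−1)/ℓ). -/

import Mathlib

/-- The orbits of a translation `c ↦ c - a` of an additive group all have `addOrderOf a` elements. -/
theorem card_orbit_zpowers_subRight {A : Type*} [AddGroup A] [Finite A] (a x : A) :
    Nat.card (MulAction.orbit (Subgroup.zpowers (Equiv.subRight a)) x) = addOrderOf a := by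
  have : Fintype (MulAction.orbit (Subgroup.zpowers (Equiv.subRight a)) x) := Fintype.ofFinite _
  rw [Nat.card_eq_fintype_card, ← MulAction.minimalPeriod_eq_card]
  have iter (n : ℕ) : (Equiv.subRight a • · : A → A)^[n] x = x - n • a := by
    induction n with
    | zero => simp
    | succ n ih =>
      rw [Function.iterate_succ_apply', ih, Equiv.Perm.smul_def, Equiv.subRight_apply,
        succ_nsmul', sub_eq_add_neg, sub_eq_add_neg, sub_eq_add_neg, neg_add_rev, add_assoc]
  refine Nat.dvd_right_iff_eq.mp fun n => ?_
  rw [← Function.isPeriodicPt_iff_minimalPeriod_dvd, addOrderOf_dvd_iff_nsmul_eq_zero,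
    Function.IsPeriodicPt, Function.IsFixedPt, iter, sub_eq_self]

/-- The number of orbits of a translation, times the order of the translating element. -/
theorem card_orbits_zpowers_subRight_mul {A : Type*} [AddGroup A] [Finite A] (a : A) :
    Nat.card (MulAction.orbitRel.Quotient (Subgroup.zpowers (Equiv.subRight a)) A) *
      addOrderOf a = Nat.card A := by
  have : Fintype (MulAction.orbitRel.Quotient (Subgroup.zpowers (Equiv.subRight a)) A) :=
    Fintype.ofFinite _
  rw [Nat.card_congr (MulAction.selfEquivSigmaOrbits (Subgroup.zpowers (Equiv.subRight a)) A),
    Nat.card_sigma]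
  simp only [card_orbit_zpowers_subRight, Finset.sum_const, Finset.card_univ, smul_eq_mul,
    Nat.card_eq_fintype_card]

/-- For `p, q ≥ 2`, `ℓ ∣ p`, `ℓ ∣ q − 1` and `N = (p−1)(q−1)/ℓ`,
the permutation `c ↦ c − q` of `ZMod N` has exactly `gcd(q, (p+q−1)/ℓ)` orbits, each
of cardinality `(p−1)(q−1)/gcd(ℓq, p+q−1)`; moreover `gcd(N, q) = gcd(q, (p+q−1)/ℓ)`. -/
theorem chain_orbit_count
    (p q ℓ N : ℕ) (hp : 2 ≤ p) (hq : 2 ≤ q) (hℓ : 1 ≤ ℓ)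
    (hℓp : ℓ ∣ p) (hℓq : ℓ ∣ (q - 1)) (hN : N = (p - 1) * (q - 1) / ℓ) :
    Nat.card (MulAction.orbitRel.Quotient
        (Subgroup.zpowers (Equiv.subRight ((q : ℕ) : ZMod N))) (ZMod N))
      = Nat.gcd q ((p + q - 1) / ℓ) ∧
    (∀ x : ZMod N,
      Nat.card (MulAction.orbit
          (Subgroup.zpowers (Equiv.subRight ((q : ℕ) : ZMod N))) x)
        = (p - 1) * (q - 1) / Nat.gcd (ℓ * q) (p + q - 1)) ∧
    Nat.gcd N q = Nat.gcd q ((p + q - 1) / ℓ) := by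
  obtain ⟨k, rfl⟩ := hℓp
  obtain ⟨m, hm⟩ := hℓq
  obtain rfl : q = ℓ * m + 1 := by omega
  have hsum : ℓ * k + (ℓ * m + 1) - 1 = ℓ * (k + m) := by rw [mul_add]; omega
  have hprod : (ℓ * k - 1) * (ℓ * m + 1 - 1) = ℓ * ((ℓ * k - 1) * m) := by
    rw [Nat.add_sub_cancel]; ring
  have hm0 : 0 < m := Nat.pos_of_ne_zero fun h => by simp [h] at hq
  rw [hprod, Nat.mul_div_cancel_left _ hℓ] at hN
  rw [hprod, hsum, Nat.mul_div_cancel_left _ hℓ, Nat.gcd_mul_left,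
    Nat.mul_div_mul_left _ _ hℓ, ← hN]
  have hNpos : 0 < N := hN ▸ Nat.mul_pos (by omega) hm0
  have hNk : N + (k + m) = (ℓ * m + 1) * k := by
    obtain ⟨r, hr⟩ : ∃ r, ℓ * k = r + 1 := ⟨ℓ * k - 1, by omega⟩
    rw [hN, hr, Nat.add_sub_cancel]
    rw [show (ℓ * m + 1) * k = ℓ * k * m + k by ring, hr]
    ring
  have hgcd : Nat.gcd N (ℓ * m + 1) = Nat.gcd (ℓ * m + 1) (k + m) := by
    apply Nat.dvd_antisymm
    · refine Nat.dvd_gcd (Nat.gcd_dvd_right _ _) ((Nat.dvd_add_right (Nat.gcd_dvd_left _ _)).mp ?_)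
      exact hNk ▸ (Nat.gcd_dvd_right _ _).mul_right k
    · refine Nat.dvd_gcd ((Nat.dvd_add_left (Nat.gcd_dvd_right _ _)).mp ?_) (Nat.gcd_dvd_left _ _)
      exact hNk ▸ (Nat.gcd_dvd_left _ _).mul_right k
  have : NeZero N := ⟨hNpos.ne'⟩
  have hord : addOrderOf ((ℓ * m + 1 : ℕ) : ZMod N) = N / Nat.gcd (ℓ * m + 1) (k + m) := by
    rw [ZMod.addOrderOf_coe _ hNpos.ne', hgcd]
  refine ⟨?_, fun x => (card_orbit_zpowers_subRight _ x).trans hord, hgcd⟩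
  have hcount := card_orbits_zpowers_subRight_mul ((ℓ * m + 1 : ℕ) : ZMod N)
  have hdvd : Nat.gcd (ℓ * m + 1) (k + m) ∣ N := hgcd ▸ Nat.gcd_dvd_left _ _
  refine Nat.eq_of_mul_eq_mul_right (addOrderOf_pos ((ℓ * m + 1 : ℕ) : ZMod N)) ?_
  rw [hcount, hord, Nat.card_zmod, Nat.mul_div_cancel' hdvd]
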